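/- Let Δ be an additive subgroup of ℂ, φ : Δ → ℂ an additive group homomorphism, and ϕ : Δ × Δ → ℂ a skew-symmetric ℤ-bilinear form. Then the free ℂ[∂]-module CL_3(ϕ,φ) = ⊕_{α ∈ Δ, i ∈ ℕ} ℂ[∂]x_{α,i} with λ-bracket [x_{α,i} λ x_{β,j}] = ∂(α x_{α+β,i+j} + i x_{α+β,i+j−1}) + λ((α+β) x_{α+β,i+j} + (i+j) x_{α+β,i+j−1}) + ϕ(β,α) x_{α+β,i+j} + (jφ(α) − iφ(β)) x_{α+β,i+j−1}, with terms of second index −1 read as 0 and the bracket extended by conformal sesquilinearity, is a simple Lie conformal algebra. -/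

import Mathlib

set_option maxSynthPendingDepth 3

namespace QLCA

variable {V : Type} [AddCommGroup V] [Module ℂ V]

/-- Bilinearity over `ℂ` of a binary product. -/
def IsBilin (f : V → V → V) : Prop :=
  (∀ x y z : V, f (x + y) z = f x z + f y z) ∧
  (∀ x y z : V, f x (y + z) = f x y + f x z) ∧
  (∀ (c : ℂ) (x y : V), f (c • x) y = c • f x y) ∧
  (∀ (c : ℂ) (x y : V), f x (c • y) = c • f x y)

/-- `(V, f)` is a Novikov algebra over `ℂ`. -/
def IsNovikov (f : V → V → V) : Prop :=
  IsBilin f ∧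
  (∀ a b c : V, f (f a b) c - f a (f b c) = f (f b a) c - f b (f a c)) ∧
  (∀ a b c : V, f (f a b) c = f (f a c) b)

/-- `I` is an ideal of the Novikov algebra `(V, f)`. -/
def IsNovikovIdeal (f : V → V → V) (I : Submodule ℂ V) : Prop :=
  ∀ a ∈ I, ∀ b : V, f a b ∈ I ∧ f b a ∈ I

/-- The Novikov algebra `(V, f)` is simple. -/
def NovikovSimple (f : V → V → V) : Prop :=
  (∃ a b : V, f a b ≠ 0) ∧
  ∀ I : Submodule ℂ V, IsNovikovIdeal f I → I = ⊥ ∨ I = ⊤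

/-- `(V, f)` is a Lie algebra over `ℂ`. -/
def IsLieBracket (f : V → V → V) : Prop :=
  IsBilin f ∧
  (∀ a b : V, f a b = - f b a) ∧
  (∀ a b c : V, f a (f b c) = f (f a b) c + f b (f a c))

/-- The Gel'fand-Dorfman compatibility condition between a Novikov product and
a Lie bracket. -/
def GDcompat (mul lie : V → V → V) : Prop :=
  ∀ a b c : V,
    lie (mul a b) c - lie (mul a c) b + mul (lie a b) c - mul (lie a c) b
      - mul a (lie b c) = 0

/-- `(V, mul, lie)` is a Gel'fand-Dorfman bialgebra. -/
def IsGD (mul lie : V → V → V) : Prop :=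
  IsNovikov mul ∧ IsLieBracket lie ∧ GDcompat mul lie

/-- `I` is a Gel'fand-Dorfman ideal of `(V, mul, lie)`. -/
def IsGDIdeal (mul lie : V → V → V) (I : Submodule ℂ V) : Prop :=
  IsNovikovIdeal mul I ∧ ∀ a ∈ I, ∀ b : V, lie a b ∈ I ∧ lie b a ∈ I

/-- The symmetrized (Novikov-Jordan) product `a ∗ b = a∘b + b∘a`. -/
def sProd (mul : V → V → V) (a b : V) : V := mul a b + mul b a

/-- `I` is an ideal of the Novikov-Jordan algebra `(V, ∗)`. -/
def IsNJIdeal (mul : V → V → V) (I : Submodule ℂ V) : Prop :=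
  ∀ a ∈ I, ∀ b : V, sProd mul a b ∈ I

/-- The Novikov-Jordan algebra `(V, ∗)` is simple. -/
def NJSimple (mul : V → V → V) : Prop :=
  (∃ a b : V, sProd mul a b ≠ 0) ∧
  ∀ I : Submodule ℂ V, IsNJIdeal mul I → I = ⊥ ∨ I = ⊤

/-- An element of the free module `R = ℂ[∂]V`, recorded by its coefficients:
`a : Conf V` represents `∑ₘ ∂^m (a m)`. -/
abbrev Conf (V : Type) [Zero V] := ℕ →₀ V

/-- A polynomial in `λ` with coefficients in `R = ℂ[∂]V`: `P : LP V`
represents `∑ₙ λ^n (P n)`. -/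
abbrev LP (V : Type) [Zero V] := ℕ →₀ (ℕ →₀ V)

/-- Multiplication by `∂` on `ℂ[∂]V`. -/
noncomputable def Dop (a : Conf V) : Conf V := Finsupp.mapDomain (· + 1) a

/-- Multiplication by `λ` on `λ`-polynomials. -/
noncomputable def lmul (P : LP V) : LP V := Finsupp.mapDomain (· + 1) P

/-- Multiplication by `∂` on `λ`-polynomials. -/
noncomputable def dmul (P : LP V) : LP V := Finsupp.mapRange (Dop (V := V)) (by simp [Dop]) P

/-- Multiplication by `λ + ∂` on `λ`-polynomials. -/
noncomputable def ldOp (P : LP V) : LP V := lmul P + dmul P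

/-- The `λ`-bracket on `R = ℂ[∂]V` obtained from the generator values `B u v`
(`u, v ∈ V`) by extension via `ℂ`-bilinearity and conformal sesquilinearity:
`[(∂^m u) λ (∂^n v)] = (-λ)^m (λ+∂)^n [u λ v]`. -/
noncomputable def qbr (B : V → V → LP V) (a b : Conf V) : LP V :=
  Finsupp.sum a fun m am => Finsupp.sum b fun n bn =>
    ((-1 : ℂ) ^ m) • (lmul (V := V))^[m] ((ldOp (V := V))^[n] (B am bn))

/-- The substitution `λ ↦ -λ-∂` in a `λ`-polynomial
(used to express skew-symmetry `[a λ b] = -[b (-λ-∂) a]`). -/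
noncomputable def nsubst (P : LP V) : LP V :=
  Finsupp.sum P fun n cn => ((-1 : ℂ) ^ n) • (ldOp (V := V))^[n] (Finsupp.single 0 cn)

/-- `I` is an ideal of `R = ℂ[∂]V` with `λ`-bracket `qbr B`: a
`ℂ[∂]`-submodule (a `ℂ`-submodule closed under `∂`) such that every
`λ`-coefficient of `[a λ x]` lies in `I` for all `a ∈ R`, `x ∈ I`. -/
def IsConfIdeal (B : V → V → LP V) (I : Submodule ℂ (Conf V)) : Prop :=
  (∀ x ∈ I, Dop x ∈ I) ∧
  (∀ a : Conf V, ∀ x ∈ I, ∀ n : ℕ, qbr B a x n ∈ I)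

/-- The conformal algebra `R = ℂ[∂]V` with `λ`-bracket `qbr B` is simple:
its `λ`-bracket is not identically zero and its only ideals are `0` and `R`. -/
def ConfSimple (B : V → V → LP V) : Prop :=
  (∃ a b : Conf V, qbr B a b ≠ 0) ∧
  ∀ I : Submodule ℂ (Conf V), IsConfIdeal B I → I = ⊥ ∨ I = ⊤

/-- `R = ℂ[∂]V` with the `λ`-bracket `qbr B` is a Lie conformal algebra: the
bracket is `ℂ`-bilinear, satisfies conformal sesquilinearity, skew-symmetry
`[a λ b] = -[b (-λ-∂) a]`, and the Jacobi identity
`[a λ [b μ c]] = [[a λ b] (λ+μ) c] + [b μ [a λ c]]` (the latter written out by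
comparing the coefficients of `λ^p μ^q` on both sides). -/
def IsLieConf (B : V → V → LP V) : Prop :=
  (∀ a b c : Conf V, qbr B (a + b) c = qbr B a c + qbr B b c) ∧
  (∀ a b c : Conf V, qbr B a (b + c) = qbr B a b + qbr B a c) ∧
  (∀ (k : ℂ) (a b : Conf V), qbr B (k • a) b = k • qbr B a b) ∧
  (∀ (k : ℂ) (a b : Conf V), qbr B a (k • b) = k • qbr B a b) ∧
  (∀ a b : Conf V, qbr B (Dop a) b = - lmul (qbr B a b)) ∧
  (∀ a b : Conf V, qbr B a (Dop b) = ldOp (qbr B a b)) ∧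
  (∀ a b : Conf V, qbr B a b = - nsubst (qbr B b a)) ∧
  (∀ a b c : Conf V, ∀ p q : ℕ,
    qbr B a (qbr B b c q) p =
      (∑ n ∈ Finset.Icc q (p + q),
        (n.choose q : ℂ) • qbr B (qbr B a b (p + q - n)) c n)
      + qbr B b (qbr B a c p) q)

/-- Generator values of the `λ`-bracket of the quadratic Lie conformal algebra
associated to a Gel'fand-Dorfman bialgebra `(V, mul, lie)`:
`[u λ v] = ∂(v∘u) + [v,u] + λ(u∘v + v∘u)`. -/
noncomputable def gdB (mul lie : V → V → V) (u v : V) : LP V :=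
  Finsupp.single 0 (Finsupp.single 1 (mul v u) + Finsupp.single 0 (lie v u))
    + Finsupp.single 1 (Finsupp.single 0 (mul u v + mul v u))

end QLCA

open QLCA

/-- The basis vector `x_{α,i}` of `A₃`. -/
noncomputable def x3 (Δ : AddSubgroup ℂ) (α : Δ) (i : ℕ) : (Δ × ℕ) →₀ ℂ :=
  Finsupp.single (α, i) 1


/-- Generator values of the `λ`-bracket of `CL₃(ϕ,φ)` on the basis `x_{α,i}`
(with `p = (α,i)`, `q = (β,j)`), extended bilinearly. -/
noncomputable def B4 (Δ : AddSubgroup ℂ) (φ : Δ →+ ℂ) (ϕ : Δ → Δ → ℂ)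
    (u v : (Δ × ℕ) →₀ ℂ) : ℕ →₀ (ℕ →₀ ((Δ × ℕ) →₀ ℂ)) :=
  Finsupp.sum u fun p up => Finsupp.sum v fun q vq => (up * vq) •
    (Finsupp.single 0
        (Finsupp.single 1
            ((p.1 : ℂ) • x3 Δ (p.1 + q.1) (p.2 + q.2)
              + (p.2 : ℂ) • x3 Δ (p.1 + q.1) (p.2 + q.2 - 1))
          + Finsupp.single 0
              (ϕ q.1 p.1 • x3 Δ (p.1 + q.1) (p.2 + q.2)
                + ((q.2 : ℂ) * φ p.1 - (p.2 : ℂ) * φ q.1)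
                  • x3 Δ (p.1 + q.1) (p.2 + q.2 - 1)))
      + Finsupp.single 1
          (Finsupp.single 0
            (((p.1 : ℂ) + (q.1 : ℂ)) • x3 Δ (p.1 + q.1) (p.2 + q.2)
              + ((p.2 : ℂ) + (q.2 : ℂ)) • x3 Δ (p.1 + q.1) (p.2 + q.2 - 1))))

namespace QLCA

section gen
variable {W : Type} [AddCommGroup W] [Module ℂ W]
variable {V : Type} [AddCommGroup V] [Module ℂ V]

/-- evaluation of a polynomial with coefficients in `W`. -/
noncomputable def ev (x : ℂ) : (ℕ →₀ W) →ₗ[ℂ] W :=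
  Finsupp.lsum ℂ (fun n => x ^ n • LinearMap.id)

@[simp] lemma ev_single (x : ℂ) (n : ℕ) (w : W) : ev x (Finsupp.single n w) = x ^ n • w := by
  simp [ev]

lemma ev_inj (P : ℕ →₀ W) (h : ∀ x, ev x P = 0) : P = 0 := by
  ext n
  rw [Finsupp.zero_apply, ← Module.forall_dual_apply_eq_zero_iff ℂ]
  intro f
  have key : ∀ (Q : ℕ →₀ W) (x : ℂ), f (ev x Q) =
      (Q.sum fun n w => Polynomial.monomial n (f w)).eval x := by
    intro Q x
    induction Q using Finsupp.induction_linear with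
    | zero => simp
    | add a b ha hb =>
      rw [map_add, map_add, ha, hb, Finsupp.sum_add_index'] <;> simp
    | single n w => simp [mul_comm]
  have h0 : (P.sum fun n w => Polynomial.monomial n (f w)) = 0 := by
    apply Polynomial.funext
    intro x
    rw [← key, h, map_zero, Polynomial.eval_zero]
  have h1 := congrArg (fun p => Polynomial.coeff p n) h0
  simp only [Finsupp.sum, Polynomial.finsetSum_coeff, Polynomial.coeff_monomial,
    Polynomial.coeff_zero] at h1
  rw [Finset.sum_ite_eq' ] at h1
  by_cases hn : n ∈ P.support
  · simpa [hn] using h1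
  · simp [Finsupp.notMem_support_iff.mp hn]

lemma ev_ext {P Q : ℕ →₀ W} (h : ∀ x, ev x P = ev x Q) : P = Q := by
  rw [← sub_eq_zero]
  apply ev_inj
  intro x
  rw [map_sub, h, sub_self]

lemma ev2_ext {P Q : LP V} (h : ∀ l s, ev s (ev l P) = ev s (ev l Q)) : P = Q :=
  ev_ext fun l => ev_ext fun s => h l s

lemma ev_shift (x : ℂ) (P : ℕ →₀ W) : ev x (Finsupp.mapDomain (· + 1) P) = x • ev x P := by
  induction P using Finsupp.induction_linear with
  | zero => simp
  | add a b ha hb => rw [Finsupp.mapDomain_add, map_add, map_add, ha, hb, smul_add]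
  | single n w => simp [Finsupp.mapDomain_single, pow_succ', mul_smul]

lemma ev_Dop (x : ℂ) (a : Conf V) : ev x (Dop a) = x • ev x a := ev_shift x a
lemma ev_lmul (x : ℂ) (P : LP V) : ev x (lmul P) = x • ev x P := ev_shift x P

lemma Dop_add (a b : Conf V) : Dop (a + b) = Dop a + Dop b := Finsupp.mapDomain_add
lemma Dop_smul (k : ℂ) (a : Conf V) : Dop (k • a) = k • Dop a := Finsupp.mapDomain_smul k a
lemma Dop_zero : Dop (0 : Conf V) = 0 := Finsupp.mapDomain_zero

lemma ev_mapRange {U : Type} [AddCommGroup U] [Module ℂ U] (f : W →ₗ[ℂ] U) (x : ℂ)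
    (P : ℕ →₀ W) : ev x (Finsupp.mapRange.linearMap f P) = f (ev x P) := by
  induction P using Finsupp.induction_linear with
  | zero => simp
  | add a b ha hb => simp only [map_add, ha, hb]
  | single n w => simp

noncomputable def DopL : Conf V →ₗ[ℂ] Conf V where
  toFun := Dop
  map_add' := Dop_add
  map_smul' := Dop_smul

lemma dmul_eq (P : LP V) : dmul P = Finsupp.mapRange.linearMap DopL P := rfl

lemma ev_dmul (x : ℂ) (P : LP V) : ev x (dmul P) = Dop (ev x P) := by
  rw [dmul_eq, ev_mapRange]; rfl

lemma ev2_ldOp (l s : ℂ) (P : LP V) :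
    ev s (ev l (ldOp P)) = (l + s) • ev s (ev l P) := by
  rw [ldOp, map_add, ev_lmul, ev_dmul, map_add, map_smul, ev_Dop, add_smul]

noncomputable def lmulL : LP V →ₗ[ℂ] LP V where
  toFun := lmul
  map_add' _ _ := Finsupp.mapDomain_add
  map_smul' k a := Finsupp.mapDomain_smul k a

noncomputable def ldOpL : LP V →ₗ[ℂ] LP V := lmulL + Finsupp.mapRange.linearMap DopL

lemma lmul_iter (m : ℕ) (P : LP V) : (lmul (V := V))^[m] P = (lmulL ^ m) P := by
  rw [Module.End.pow_apply]; rfl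

lemma ldOp_iter (m : ℕ) (P : LP V) : (ldOp (V := V))^[m] P = (ldOpL ^ m) P := by
  rw [Module.End.pow_apply]; rfl

lemma ev2_ldOp_iter (l s : ℂ) (n : ℕ) (P : LP V) :
    ev s (ev l ((ldOpL ^ n) P)) = (l + s) ^ n • ev s (ev l P) := by
  induction n with
  | zero => simp
  | succ n ih =>
    rw [pow_succ', Module.End.mul_apply, show ldOpL ((ldOpL ^ n) P) = ldOp ((ldOpL ^ n) P) from rfl,
      ev2_ldOp, ih, smul_smul, pow_succ']

lemma ev_lmul_iter (l : ℂ) (n : ℕ) (P : LP V) :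
    ev l ((lmulL ^ n) P) = l ^ n • ev l P := by
  induction n with
  | zero => simp
  | succ n ih =>
    rw [pow_succ', Module.End.mul_apply, show lmulL ((lmulL ^ n) P) = lmul ((lmulL ^ n) P) from rfl,
      ev_lmul, ih, smul_smul, pow_succ']

/-- bundled bracket. -/
noncomputable def qL (B : V →ₗ[ℂ] V →ₗ[ℂ] LP V) : Conf V →ₗ[ℂ] Conf V →ₗ[ℂ] LP V :=
  Finsupp.lsum ℂ fun m => LinearMap.flip <| Finsupp.lsum ℂ fun n =>
    LinearMap.flip <| B.compr₂ (((-1 : ℂ) ^ m) • (lmulL ^ m * ldOpL ^ n))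

lemma qL_eq (B : V →ₗ[ℂ] V →ₗ[ℂ] LP V) (a b : Conf V) :
    qbr (fun u v => B u v) a b = qL B a b := by
  simp only [qbr, qL, Finsupp.lsum_apply, Finsupp.sum, LinearMap.sum_apply, LinearMap.flip_apply,
    LinearMap.compr₂_apply, lmul_iter, ldOp_iter, LinearMap.smul_apply, Module.End.mul_apply]

lemma qL_single (B : V →ₗ[ℂ] V →ₗ[ℂ] LP V) (m n : ℕ) (u v : V) :
    qL B (Finsupp.single m u) (Finsupp.single n v)
      = ((-1 : ℂ) ^ m) • (lmulL ^ m) ((ldOpL ^ n) (B u v)) := by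
  simp [qL]

lemma ev2_qL (B : V →ₗ[ℂ] V →ₗ[ℂ] LP V) (a b : Conf V) (l s : ℂ) :
    ev s (ev l (qL B a b)) = ev s (ev l (B (ev (-l) a) (ev (l + s) b))) := by
  induction a using Finsupp.induction_linear with
  | zero => simp
  | add a b ha hb => simp only [map_add, LinearMap.add_apply, ha, hb]
  | single m u =>
    induction b using Finsupp.induction_linear with
    | zero => simp
    | add a b ha hb => simp only [map_add, ha, hb]
    | single n v =>
      simp only [qL_single, ev_single, map_smul, LinearMap.smul_apply, ev_lmul_iter, ev2_ldOp_iter,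
        smul_smul]
      congr 1
      rw [neg_pow l m]; ring

/-- bundled substitution. -/
lemma ev2_nsubst (l s : ℂ) (P : LP V) :
    ev s (ev l (nsubst P)) = ev s (ev (-l - s) P) := by
  have : ∀ P : LP V, nsubst P = Finsupp.lsum ℂ (fun n => ((-1 : ℂ) ^ n) •
      ((ldOpL ^ n) ∘ₗ Finsupp.lsingle (M := Conf V) (R := ℂ) 0)) P := by
    intro P
    simp only [nsubst, Finsupp.lsum_apply, ldOp_iter]
    rfl
  rw [this]
  induction P using Finsupp.induction_linear with
  | zero => simp
  | add a b ha hb => simp only [map_add, ha, hb]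
  | single n v =>
    simp only [Finsupp.lsum_single, LinearMap.smul_apply, LinearMap.comp_apply, map_smul,
      ev2_ldOp_iter, Finsupp.lsingle_apply, ev_single, smul_smul, pow_zero, one_smul]
    congr 1
    rw [← mul_pow]; congr 1; ring

/-- transposition of the two indices. -/
noncomputable def flipL : (ℕ →₀ ℕ →₀ W) →ₗ[ℂ] (ℕ →₀ ℕ →₀ W) :=
  Finsupp.lsum ℂ fun p => Finsupp.lsum ℂ fun q =>
    Finsupp.lsingle (M := ℕ →₀ W) q ∘ₗ Finsupp.lsingle (M := W) p

lemma flipL_apply (P : ℕ →₀ ℕ →₀ W) (p q : ℕ) : flipL P q p = P p q := by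
  induction P using Finsupp.induction_linear with
  | zero => simp
  | add a b ha hb => simp only [map_add, Finsupp.add_apply, ha, hb]
  | single m u =>
    induction u using Finsupp.induction_linear with
    | zero => simp
    | add a b ha hb => simp only [map_add, Finsupp.add_apply, ha, hb, Finsupp.single_add]
    | single n v =>
      simp only [flipL, Finsupp.lsum_single, LinearMap.comp_apply, Finsupp.lsingle_apply]
      by_cases h1 : m = p <;> by_cases h2 : n = q <;> simp [Finsupp.single_apply, h1, h2]

lemma ev2_flipL (P : ℕ →₀ ℕ →₀ W) (l m : ℂ) : ev l (ev m (flipL P)) = ev m (ev l P) := by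
  induction P using Finsupp.induction_linear with
  | zero => simp
  | add a b ha hb => simp only [map_add, ha, hb]
  | single p u =>
    induction u using Finsupp.induction_linear with
    | zero => simp
    | add a b ha hb => simp only [map_add, ha, hb, Finsupp.single_add]
    | single n v =>
      simp only [flipL, Finsupp.lsum_single, LinearMap.comp_apply, Finsupp.lsingle_apply, ev_single,
        map_smul, smul_smul, mul_comm]

/-- `∑ λ^k (λ+μ)^n P k n`, re-expanded; outer index is the power of `μ`. -/
noncomputable def expL : (ℕ →₀ ℕ →₀ W) →ₗ[ℂ] (ℕ →₀ ℕ →₀ W) :=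
  Finsupp.lsum ℂ fun k => Finsupp.lsum ℂ fun n =>
    ∑ q ∈ Finset.range (n + 1), (n.choose q : ℂ) •
      (Finsupp.lsingle (M := ℕ →₀ W) q ∘ₗ Finsupp.lsingle (M := W) (k + (n - q)))

lemma expL_apply (P : ℕ →₀ ℕ →₀ W) (p q : ℕ) :
    expL P q p = ∑ n ∈ Finset.Icc q (p + q), (n.choose q : ℂ) • P (p + q - n) n := by
  induction P using Finsupp.induction_linear with
  | zero => simp
  | add a b ha hb =>
    simp only [map_add, Finsupp.add_apply, ha, hb, smul_add, Finset.sum_add_distrib]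
  | single k u =>
    induction u using Finsupp.induction_linear with
    | zero => simp
    | add a b ha hb =>
      simp only [map_add, Finsupp.add_apply, ha, hb, Finsupp.single_add, smul_add,
        Finset.sum_add_distrib]
    | single n v =>
      simp only [expL, Finsupp.lsum_single, LinearMap.comp_apply, Finsupp.lsingle_apply,
        LinearMap.sum_apply, LinearMap.smul_apply, Finsupp.finsetSum_apply, Finsupp.smul_apply]
      have e1 : ∀ q' : ℕ, (n.choose q' : ℂ) •
          (((Finsupp.single q' (Finsupp.single (k + (n - q')) v)) : ℕ →₀ ℕ →₀ W) q) p
          = if q' = q then (if k + (n - q) = p then (n.choose q : ℂ) • v else 0) else 0 := by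
        intro q'
        by_cases h : q' = q
        · subst h
          simp [Finsupp.single_apply]
        · simp [h]
      have e2 : ∀ n' : ℕ, (n'.choose q : ℂ) •
          (((Finsupp.single k (Finsupp.single n v)) : ℕ →₀ ℕ →₀ W) (p + q - n')) n'
          = if n' = n then (if k = p + q - n then (n.choose q : ℂ) • v else 0) else 0 := by
        intro n'
        by_cases h : n' = n
        · subst h
          by_cases h2 : k = p + q - n'
          · simp [h2]
          · simp [h2]
        · by_cases h2 : k = p + q - n'
          · rw [← h2]; simp [Ne.symm h, h]
          · simp [h2, h]
      simp only [e1, e2, Finset.sum_ite_eq', Finset.mem_range, Finset.mem_Icc]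
      split_ifs <;> first | rfl | (exfalso; omega) 

lemma ev2_expL (P : ℕ →₀ ℕ →₀ W) (l m : ℂ) :
    ev l (ev m (expL P)) = ev (l + m) (ev l P) := by
  induction P using Finsupp.induction_linear with
  | zero => simp
  | add a b ha hb => simp only [map_add, ha, hb]
  | single k u =>
    induction u using Finsupp.induction_linear with
    | zero => simp
    | add a b ha hb => simp only [map_add, ha, hb, Finsupp.single_add]
    | single n v =>
      simp only [expL, Finsupp.lsum_single, LinearMap.comp_apply, Finsupp.lsingle_apply,
        LinearMap.sum_apply, LinearMap.smul_apply, ev_single, map_sum, map_smul, smul_smul]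
      rw [← Finset.sum_smul]
      congr 1
      rw [add_comm l m, add_pow, Finset.mul_sum]
      apply Finset.sum_congr rfl
      intro q _
      rw [pow_add]; ring

/-- Reduction of the Lie conformal axioms to identities of the evaluated bracket on `V`. -/
theorem isLieConf_of (B : V →ₗ[ℂ] V →ₗ[ℂ] LP V)
    (hsk : ∀ (l s : ℂ) (u v : V), ev s (ev l (B u v)) = - ev s (ev (-l - s) (B v u)))
    (hj : ∀ (l m s : ℂ) (u v w : V),
      ev s (ev l (B u (ev (l + s) (ev m (B v w)))))
      = ev s (ev (l + m) (B (ev (-(l + m)) (ev l (B u v))) w))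
        + ev s (ev m (B v (ev (m + s) (ev l (B u w)))))) :
    IsLieConf (fun u v => B u v) := by
  refine ⟨?_, ?_, ?_, ?_, ?_, ?_, ?_, ?_⟩
  · intro a b c; simp only [qL_eq, map_add, LinearMap.add_apply]
  · intro a b c; simp only [qL_eq, map_add]
  · intro k a b; simp only [qL_eq, map_smul, LinearMap.smul_apply]
  · intro k a b; simp only [qL_eq, map_smul]
  · intro a b
    apply ev2_ext
    intro l s
    simp only [qL_eq, map_neg, ev_lmul, map_smul, ev2_qL, ev_Dop, LinearMap.smul_apply, neg_smul,
      LinearMap.neg_apply]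
  · intro a b
    apply ev2_ext
    intro l s
    simp only [qL_eq, ev2_ldOp, map_smul, ev2_qL, ev_Dop]
  · intro a b
    apply ev2_ext
    intro l s
    simp only [qL_eq, map_neg, ev2_nsubst, ev2_qL]
    rw [hsk]
    rw [show -(-l - s) = l + s by ring, show -l - s + s = -l by ring]
  · intro a b c p q
    simp only [qL_eq]
    set L1 : ℕ →₀ LP V := Finsupp.mapRange.linearMap (qL B a) (qL B b c) with hL1
    set L3 : ℕ →₀ LP V := Finsupp.mapRange.linearMap (qL B b) (qL B a c) with hL3
    set L2 : ℕ →₀ LP V := Finsupp.mapRange.linearMap ((qL B).flip c) (qL B a b) with hL2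
    have key : L1 = expL L2 + flipL L3 := by
      apply ev_ext
      intro m
      apply ev_ext
      intro l
      apply ev_ext
      intro s
      rw [map_add, map_add, ev2_expL, ev2_flipL, hL1, hL2, hL3, ev_mapRange, ev_mapRange,
        ev_mapRange, LinearMap.flip_apply, map_add]
      simp only [ev2_qL]
      rw [show l + -(l + m) = -m by ring, show m + (l + s) = l + m + s by ring,
        show l + (m + s) = l + m + s by ring, hj]
    have h := congrArg (fun F : ℕ →₀ LP V => F q p) key
    simp only [Finsupp.add_apply, expL_apply, flipL_apply] at h
    exact h

end gen
end QLCA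

namespace QLCA
section concrete
variable (Δ : AddSubgroup ℂ) (φ : Δ →+ ℂ) (ϕ : Δ → Δ → ℂ)

/-- bracket of basis vectors -/
noncomputable def gB (p q : Δ × ℕ) : ℕ →₀ (ℕ →₀ ((Δ × ℕ) →₀ ℂ)) :=
  (Finsupp.single 0
        (Finsupp.single 1
            ((p.1 : ℂ) • x3 Δ (p.1 + q.1) (p.2 + q.2)
              + (p.2 : ℂ) • x3 Δ (p.1 + q.1) (p.2 + q.2 - 1))
          + Finsupp.single 0
              (ϕ q.1 p.1 • x3 Δ (p.1 + q.1) (p.2 + q.2)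
                + ((q.2 : ℂ) * φ p.1 - (p.2 : ℂ) * φ q.1)
                  • x3 Δ (p.1 + q.1) (p.2 + q.2 - 1)))
      + Finsupp.single 1
          (Finsupp.single 0
            (((p.1 : ℂ) + (q.1 : ℂ)) • x3 Δ (p.1 + q.1) (p.2 + q.2)
              + ((p.2 : ℂ) + (q.2 : ℂ)) • x3 Δ (p.1 + q.1) (p.2 + q.2 - 1))))

noncomputable def BL : ((Δ × ℕ) →₀ ℂ) →ₗ[ℂ] ((Δ × ℕ) →₀ ℂ) →ₗ[ℂ] LP ((Δ × ℕ) →₀ ℂ) :=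
  Finsupp.linearCombination ℂ fun p => Finsupp.linearCombination ℂ (gB Δ φ ϕ p)

lemma B4_eq : B4 Δ φ ϕ = fun u v => BL Δ φ ϕ u v := by
  funext u v
  simp only [B4, BL, Finsupp.linearCombination_apply, Finsupp.sum, LinearMap.sum_apply,
    LinearMap.smul_apply, Finset.smul_sum, smul_smul]
  rfl

lemma BL_single (p q : Δ × ℕ) (c d : ℂ) :
    BL Δ φ ϕ (Finsupp.single p c) (Finsupp.single q d) = (c * d) • gB Δ φ ϕ p q := by
  simp [BL, smul_smul]

/-- `f(t) ↦ x_α f(t)` -/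
noncomputable def EE (α : Δ) : Polynomial ℂ →ₗ[ℂ] ((Δ × ℕ) →₀ ℂ) :=
  Polynomial.lsum fun i => Finsupp.lsingle (α, i)

lemma EE_monomial (α : Δ) (i : ℕ) (c : ℂ) :
    EE Δ α (Polynomial.monomial i c) = Finsupp.single (α, i) c := by
  simp [EE, Polynomial.lsum_apply]

open Polynomial in
lemma ev_BL (l s : ℂ) (α β : Δ) (f g : Polynomial ℂ) :
    ev s (ev l (BL Δ φ ϕ (EE Δ α f) (EE Δ β g))) = EE Δ (α + β)
      (C (s * α + l * (α + β) + ϕ β α) * (f * g)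
        + C (s + l - φ β) * (derivative f * g) + C (l + φ α) * (f * derivative g)) := by
  induction f using Polynomial.induction_on' with
  | add f1 f2 h1 h2 =>
    rw [map_add (EE Δ α), map_add (BL Δ φ ϕ), LinearMap.add_apply, map_add (ev l), map_add (ev s),
      h1, h2, ← map_add (EE Δ (α + β)), map_add derivative]
    congr 1; ring
  | monomial i c =>
    induction g using Polynomial.induction_on' with
    | add f1 f2 h1 h2 =>
      rw [map_add (EE Δ β), map_add (BL Δ φ ϕ _), map_add (ev l), map_add (ev s),
        h1, h2, ← map_add (EE Δ (α + β)), map_add derivative]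
      congr 1; ring
    | monomial j d =>
      rw [EE_monomial, EE_monomial, BL_single]
      simp only [derivative_monomial, monomial_mul_monomial, C_mul_monomial, map_add (EE Δ (α + β)),
        map_add (ev l), map_add (ev s), EE_monomial, gB, x3, ev_single, map_smul, Finsupp.smul_single, smul_eq_mul]
      have h1 : ∀ z : ℂ, Finsupp.single (α + β, i - 1 + j) (z * (c * i * d))
          = Finsupp.single (α + β, i + j - 1) (z * (c * i * d)) := by
        intro z
        rcases i with _ | i
        · simp
        · congr 2; omega
      have h2 : ∀ z : ℂ, Finsupp.single (α + β, i + (j - 1)) (z * (c * (d * j)))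
          = Finsupp.single (α + β, i + j - 1) (z * (c * (d * j))) := by
        intro z
        rcases j with _ | j
        · simp
        · congr 2
      rw [h1, h2]
      ext q
      simp only [Finsupp.add_apply, Finsupp.single_apply, Finsupp.smul_apply, smul_eq_mul]
      split_ifs <;> push_cast <;> ring

lemma V_ind (P : ((Δ × ℕ) →₀ ℂ) → Prop) (h0 : P 0) (ha : ∀ u v, P u → P v → P (u + v))
    (hE : ∀ α f, P (EE Δ α f)) (u) : P u := by
  induction u using Finsupp.induction_linear with
  | zero => exact h0
  | add a b h1 h2 => exact ha _ _ h1 h2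
  | single p c => rw [← EE_monomial]; exact hE _ _

open Polynomial in
theorem B4_lie (haddl : ∀ α β γ : Δ, ϕ (α + β) γ = ϕ α γ + ϕ β γ)
    (haddr : ∀ α β γ : Δ, ϕ α (β + γ) = ϕ α β + ϕ α γ)
    (hskew : ∀ α β : Δ, ϕ α β = - ϕ β α) : IsLieConf (B4 Δ φ ϕ) := by
  rw [B4_eq]
  apply isLieConf_of
  · intro l s u v
    induction u using V_ind with
    | h0 => simp
    | ha a b h1 h2 =>
      simp only [map_add, LinearMap.add_apply, h1, h2, neg_add]
    | hE α f =>
      induction v using V_ind with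
      | h0 => simp
      | ha a b h1 h2 =>
        simp only [map_add, LinearMap.add_apply, h1, h2, neg_add]
      | hE β g =>
        rw [ev_BL, ev_BL, add_comm β α, ← map_neg, hskew β α]
        congr 1
        simp only [map_add, map_sub, map_mul, map_neg]
        ring
  · intro l m s u v w
    induction u using V_ind with
    | h0 => simp
    | ha a b h1 h2 =>
      simp only [map_add, LinearMap.add_apply, h1, h2]; abel
    | hE α f =>
      induction v using V_ind with
      | h0 => simp
      | ha a b h1 h2 =>
        simp only [map_add, LinearMap.add_apply, h1, h2]; abel
      | hE β g =>
        induction w using V_ind with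
        | h0 => simp
        | ha a b h1 h2 =>
          simp only [map_add, h1, h2]; abel
        | hE γ h =>
          simp only [ev_BL]
          rw [show β + (α + γ) = α + β + γ by abel, show α + (β + γ) = α + β + γ by abel, ← map_add]
          congr 1
          simp only [haddl, haddr, AddSubgroup.coe_add, map_add, map_sub, map_mul, map_neg,
            derivative_mul, derivative_C, hskew β α]
          ring

/-! ### simplicity -/

lemma ldOpL_succ {V : Type} [AddCommGroup V] [Module ℂ V] (P : LP V) (k : ℕ) :
    ldOpL P (k + 1) = P k + Dop (P (k + 1)) := by
  have h : lmulL P (k + 1) = P k :=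
    Finsupp.mapDomain_apply (add_left_injective 1) P k
  rw [ldOpL, LinearMap.add_apply, Finsupp.add_apply, h]
  rfl

lemma ldOpL_top {V : Type} [AddCommGroup V] [Module ℂ V] (P : LP V) (hP : ∀ k, 1 < k → P k = 0)
    (n : ℕ) : (ldOpL ^ n) P (n + 1) = P 1 ∧ ∀ k, n + 1 < k → (ldOpL ^ n) P k = 0 := by
  induction n with
  | zero => exact ⟨by simp, fun k hk => by simpa using hP k (by omega)⟩
  | succ n ih =>
    constructor
    · rw [pow_succ', Module.End.mul_apply, ldOpL_succ, ih.1, ih.2 _ (by omega), Dop_zero, add_zero]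
    · intro k hk
      obtain ⟨k, rfl⟩ : ∃ j, k = j + 1 := ⟨k - 1, by omega⟩
      rw [pow_succ', Module.End.mul_apply, ldOpL_succ, ih.2 _ (by omega), ih.2 _ (by omega),
        Dop_zero, add_zero]

noncomputable def DL : ((Δ × ℕ) →₀ ℂ) →ₗ[ℂ] ((Δ × ℕ) →₀ ℂ) :=
  Finsupp.linearCombination ℂ fun p => (p.1 : ℂ) • x3 Δ p.1 p.2 + (p.2 : ℂ) • x3 Δ p.1 (p.2 - 1)

noncomputable def sh (p : Δ × ℕ) : ((Δ × ℕ) →₀ ℂ) →ₗ[ℂ] ((Δ × ℕ) →₀ ℂ) :=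
  Finsupp.lmapDomain ℂ ℂ (p + ·)

lemma sh_single (p q : Δ × ℕ) (c : ℂ) :
    sh Δ p (Finsupp.single q c) = Finsupp.single (p + q) c := by
  simp [sh]

lemma sh_sh (p q : Δ × ℕ) (v) : sh Δ p (sh Δ q v) = sh Δ (p + q) v := by
  induction v using Finsupp.induction_linear with
  | zero => simp
  | add a b h1 h2 => simp only [map_add, h1, h2]
  | single r c => simp only [sh_single, add_assoc]

lemma sh_zero (v) : sh Δ 0 v = v := by
  induction v using Finsupp.induction_linear with
  | zero => simp
  | add a b h1 h2 => simp only [map_add, h1, h2]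
  | single r c => simp only [sh_single, zero_add]

lemma BL_one (p : Δ × ℕ) (v) :
    BL Δ φ ϕ (Finsupp.single p 1) v 1 = Finsupp.single 0 (DL Δ (sh Δ p v)) := by
  induction v using Finsupp.induction_linear with
  | zero => simp
  | add a b h1 h2 => simp only [map_add, Finsupp.add_apply, h1, h2, Finsupp.single_add]
  | single r c =>
    rw [sh_single, BL_single]
    simp [gB, DL]

lemma BL_high (p : Δ × ℕ) (v) (k : ℕ) (hk : 1 < k) :
    BL Δ φ ϕ (Finsupp.single p 1) v k = 0 := by
  induction v using Finsupp.induction_linear with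
  | zero => simp
  | add a b h1 h2 => simp only [map_add, Finsupp.add_apply, h1, h2, add_zero]
  | single r c =>
    rw [BL_single]
    have h0 : (0 : ℕ) ≠ k := by omega
    have h1 : (1 : ℕ) ≠ k := by omega
    simp [gB, Finsupp.single_apply, h0, h1]

lemma qL_top (p : Δ × ℕ) (x : Conf ((Δ × ℕ) →₀ ℂ)) (N : ℕ) (hN : ∀ n, N < n → x n = 0) :
    qL (BL Δ φ ϕ) (Finsupp.single 0 (Finsupp.single p 1)) x (N + 1)
      = Finsupp.single 0 (DL Δ (sh Δ p (x N))) := by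
  have hx : x = ∑ n ∈ Finset.range (N + 1), Finsupp.single n (x n) := by
    conv_lhs => rw [← Finsupp.sum_single x]
    apply Finsupp.sum_of_support_subset
    · intro n hn
      rw [Finset.mem_range]
      by_contra h
      exact Finsupp.mem_support_iff.mp hn (hN n (by omega))
    · simp
  conv_lhs => rw [hx]
  rw [map_sum, Finsupp.finsetSum_apply, Finset.sum_range_succ, Finset.sum_eq_zero, zero_add,
    qL_single]
  · simp only [pow_zero, one_smul, Module.End.one_apply]
    rw [(ldOpL_top _ (fun k hk => BL_high Δ φ ϕ p _ k hk) N).1, BL_one]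
  · intro n hn
    rw [qL_single]
    simp only [pow_zero, one_smul, Module.End.one_apply]
    exact (ldOpL_top _ (fun k hk => BL_high Δ φ ϕ p _ k hk) n).2 _
      (by have := Finset.mem_range.mp hn; omega)

lemma DL_single (α : Δ) (i : ℕ) (c : ℂ) : DL Δ (Finsupp.single (α, i) c)
    = Finsupp.single (α, i) (c * α) + Finsupp.single (α, i - 1) (c * i) := by
  simp [DL, x3]

lemma DL_apply (v : (Δ × ℕ) →₀ ℂ) (α : Δ) (i : ℕ) :
    DL Δ v (α, i) = α * v (α, i) + (i + 1) * v (α, i + 1) := by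
  induction v using Finsupp.induction_linear with
  | zero => simp
  | add a b h1 h2 => simp only [map_add, Finsupp.add_apply, h1, h2]; ring
  | single r c =>
    obtain ⟨β, j⟩ := r
    rw [DL_single]
    simp only [Finsupp.add_apply, Finsupp.single_apply, Prod.mk.injEq]
    by_cases hb : β = α
    · subst hb
      rcases j with _ | j
      · by_cases h : (0 : ℕ) = i
        · subst h; simp [mul_comm]
        · simp [h]
      · by_cases h : j + 1 = i
        · subst h
          simp [mul_comm]
        · by_cases h' : j = i
          · subst h'; simp [mul_comm]
          · simp [h, h']
    · simp [hb]

lemma DL_surj (u : (Δ × ℕ) →₀ ℂ) : ∃ v, DL Δ v = u := by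
  induction u using Finsupp.induction_linear with
  | zero => exact ⟨0, map_zero _⟩
  | add a b h1 h2 =>
    obtain ⟨v, rfl⟩ := h1
    obtain ⟨w, rfl⟩ := h2
    exact ⟨v + w, map_add _ _ _⟩
  | single r c =>
    obtain ⟨α, i⟩ := r
    by_cases hα : (α : ℂ) = 0
    · refine ⟨Finsupp.single (α, i + 1) (c / (i + 1 : ℕ)), ?_⟩
      have h : ((i + 1 : ℕ) : ℂ) ≠ 0 := by exact_mod_cast Nat.succ_ne_zero i
      rw [DL_single, hα, div_mul_cancel₀ _ h]
      simp
    · induction i generalizing c with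
      | zero =>
        refine ⟨Finsupp.single (α, 0) (c / α), ?_⟩
        rw [DL_single, div_mul_cancel₀ _ hα]
        simp
      | succ i ih =>
        obtain ⟨v, hv⟩ := ih (c / α * (i + 1 : ℕ))
        refine ⟨Finsupp.single (α, i + 1) (c / α) - v, ?_⟩
        rw [map_sub, hv, DL_single, div_mul_cancel₀ _ hα]
        simp

lemma eigen (v : (Δ × ℕ) →₀ ℂ) (hv : v ≠ 0) (μ : ℂ) (h : DL Δ v = μ • v) :
    ∃ (α : Δ) (c : ℂ), c ≠ 0 ∧ v = Finsupp.single (α, 0) c := by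
  have hc : ∀ (α : Δ) (i : ℕ), (α : ℂ) * v (α, i) + (i + 1) * v (α, i + 1) = μ * v (α, i) := by
    intro α i
    rw [← DL_apply, h]; rfl
  have h1 : ∀ q : Δ × ℕ, v q ≠ 0 → (q.1 : ℂ) = μ := by
    intro q hq
    obtain ⟨r, hr, hmax⟩ := Finset.exists_max_image (v.support.filter fun r => r.1 = q.1)
      (fun r => r.2) ⟨q, by simp [hq]⟩
    simp only [Finset.mem_filter, Finsupp.mem_support_iff] at hr hmax
    have h0 : v (r.1, r.2 + 1) = 0 := by
      by_contra hne
      have := hmax (r.1, r.2 + 1) ⟨hne, hr.2⟩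
      simp at this
    have h2 := hc r.1 r.2
    rw [h0, mul_zero, add_zero] at h2
    rw [← hr.2]
    exact mul_right_cancel₀ hr.1 h2
  have h2 : ∀ q : Δ × ℕ, v q ≠ 0 → q.2 = 0 := by
    rintro ⟨α, i⟩ hq
    rcases i with _ | i
    · rfl
    · exfalso
      have h3 := hc α i
      rw [h1 _ hq] at h3
      have h4 : ((i : ℂ) + 1) * v (α, i + 1) = 0 := by linear_combination h3
      rcases mul_eq_zero.mp h4 with h5 | h5
      · exact Nat.cast_add_one_ne_zero i h5
      · exact hq h5
  obtain ⟨p, hp⟩ := Finsupp.ne_iff.mp hv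
  rw [Finsupp.zero_apply] at hp
  refine ⟨p.1, v p, hp, ?_⟩
  have hpp : p = (p.1, 0) := Prod.ext rfl (h2 p hp)
  ext q
  by_cases hq : v q = 0
  · rw [hq, Finsupp.single_apply, if_neg]
    rintro rfl
    rw [← hpp] at hq
    exact hp hq
  · have : q = p := Prod.ext (Subtype.ext ((h1 q hq).trans (h1 p hp).symm))
      ((h2 q hq).trans (h2 p hp).symm)
    rw [this, ← hpp, Finsupp.single_eq_same]

lemma diff_simple (J : Submodule ℂ ((Δ × ℕ) →₀ ℂ)) (hD : ∀ v ∈ J, DL Δ v ∈ J)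
    (w : (Δ × ℕ) →₀ ℂ) (hw : w ∈ J) (hw0 : w ≠ 0) :
    ∃ (α : Δ) (c : ℂ), c ≠ 0 ∧ Finsupp.single (α, 0) c ∈ J := by
  classical
  set A : Finset Δ := w.support.image Prod.fst
  set N : ℕ := w.support.sup Prod.snd
  set T : Finset (Δ × ℕ) := A ×ˢ Finset.range (N + 1)
  set S := Finsupp.supported ℂ ℂ (T : Set (Δ × ℕ))
  have hwS : w ∈ S := by
    rw [Finsupp.mem_supported]
    intro p hp
    have hp' : p ∈ w.support := hp
    simp only [T, Finset.coe_product, Set.mem_prod, Finset.mem_coe, Finset.mem_range]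
    refine ⟨Finset.mem_image_of_mem _ hp', Nat.lt_succ_of_le (Finset.le_sup (f := Prod.snd) hp')⟩
  have hSD : ∀ v ∈ S, DL Δ v ∈ S := by
    intro v hv
    rw [Finsupp.mem_supported'] at hv ⊢
    rintro ⟨α, i⟩ hp
    rw [DL_apply, hv _ hp, hv (α, i + 1), mul_zero, mul_zero, add_zero]
    intro h
    apply hp
    simp only [T, Finset.coe_product, Set.mem_prod, Finset.mem_coe, Finset.mem_range] at h ⊢
    exact ⟨h.1, by omega⟩
  have : FiniteDimensional ℂ S :=
    Module.Finite.equiv (Finsupp.supportedEquivFinsupp (M := ℂ) (R := ℂ) (T : Set (Δ × ℕ))).symm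
  have : FiniteDimensional ℂ (S ⊓ J : Submodule ℂ _) :=
    Submodule.finiteDimensional_of_le (inf_le_left : S ⊓ J ≤ S)
  have : Nontrivial (S ⊓ J : Submodule ℂ _) :=
    ⟨⟨⟨w, hwS, hw⟩, 0, fun h => hw0 (congrArg Subtype.val h)⟩⟩
  let f : Module.End ℂ (S ⊓ J : Submodule ℂ _) :=
    (DL Δ).restrict (p := S ⊓ J) (q := S ⊓ J) (fun v hv => ⟨hSD v hv.1, hD v hv.2⟩)
  obtain ⟨μ, hμ⟩ := Module.End.exists_eigenvalue f
  obtain ⟨v, hv⟩ := hμ.exists_hasEigenvector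
  have h1 := congrArg Subtype.val hv.apply_eq_smul
  obtain ⟨α, c, hc, he⟩ := eigen Δ v.1 (fun h => hv.2 (Subtype.ext h)) μ h1
  exact ⟨α, c, hc, he ▸ v.2.2⟩

theorem B4_simple : ConfSimple (B4 Δ φ ϕ) := by
  rw [B4_eq]
  constructor
  · refine ⟨Finsupp.single 0 (Finsupp.single (0, 1) 1), Finsupp.single 0 (Finsupp.single 0 1), ?_⟩
    rw [qL_eq]
    intro h
    have h1 := qL_top Δ φ ϕ (0, 1) (Finsupp.single 0 (Finsupp.single 0 1)) 0
      (fun n hn => by rw [Finsupp.single_apply, if_neg (by omega)])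
    rw [h, Finsupp.single_eq_same, sh_single, add_zero, DL_single] at h1
    have h2 := congrArg (fun F : Conf ((Δ × ℕ) →₀ ℂ) => F 0 (0, 0)) h1
    simp at h2
  · intro I hI
    obtain ⟨hID, hIB⟩ := hI
    by_cases hbot : I = ⊥
    · exact Or.inl hbot
    right
    let J : Submodule ℂ ((Δ × ℕ) →₀ ℂ) :=
      ⨅ p : Δ × ℕ, I.comap (Finsupp.lsingle 0 ∘ₗ DL Δ ∘ₗ sh Δ p)
    have hJ : ∀ w, w ∈ J ↔ ∀ p, Finsupp.single 0 (DL Δ (sh Δ p w)) ∈ I := by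
      intro w
      simp [J, Submodule.mem_iInf]
    have htop : ∀ x ∈ I, ∀ N, (∀ n, N < n → x n = 0) → x N ∈ J := by
      intro x hx N hN
      rw [hJ]
      intro p
      have := hIB (Finsupp.single 0 (Finsupp.single p 1)) x hx (N + 1)
      rwa [qL_eq, qL_top Δ φ ϕ p x N hN] at this
    have hJD : ∀ v ∈ J, DL Δ v ∈ J := by
      intro v hv
      have h1 := (hJ v).mp hv 0
      rw [sh_zero] at h1
      have h2 := htop _ h1 0 (fun n hn => by rw [Finsupp.single_apply, if_neg (by omega)])
      rwa [Finsupp.single_eq_same] at h2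
    obtain ⟨x, hx, hx0⟩ := (Submodule.ne_bot_iff I).mp hbot
    have hne : x.support.Nonempty := Finsupp.support_nonempty_iff.mpr hx0
    obtain ⟨α, c, hc, hαc⟩ := diff_simple Δ J hJD (x (x.support.max' hne))
      (htop x hx _ (fun n hn => by
        by_contra h
        exact absurd (Finset.le_max' _ n (Finsupp.mem_support_iff.mpr h)) (by omega)))
      (Finsupp.mem_support_iff.mp (Finset.max'_mem _ hne))
    have hD : ∀ u, Finsupp.single 0 (DL Δ u) ∈ I := by
      intro u
      induction u using Finsupp.induction_linear with
      | zero => simp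
      | add a b h1 h2 => rw [map_add, Finsupp.single_add]; exact I.add_mem h1 h2
      | single r d =>
        have h1 := (hJ _).mp hαc (r + (-α, 0))
        rw [sh_single] at h1
        have h2 : r + (-α, 0) + (α, 0) = r := by ext <;> simp
        rw [h2] at h1
        have h3 := I.smul_mem (d / c) h1
        rw [Finsupp.smul_single, ← map_smul, Finsupp.smul_single, smul_eq_mul,
          div_mul_cancel₀ _ hc] at h3
        exact h3
    have hS : ∀ n u, Finsupp.single n u ∈ I := by
      intro n u
      induction n with
      | zero =>
        obtain ⟨v, rfl⟩ := DL_surj Δ u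
        exact hD v
      | succ n ih =>
        have := hID _ ih
        rwa [Dop, Finsupp.mapDomain_single] at this
    rw [eq_top_iff]
    intro y _
    induction y using Finsupp.induction_linear with
    | zero => exact I.zero_mem
    | add a b h1 h2 => exact I.add_mem (h1 trivial) (h2 trivial)
    | single n u => exact hS n u

end concrete
end QLCA

/-- for an additive group homomorphism `φ : Δ → ℂ` and a
skew-symmetric `ℤ`-bilinear form `ϕ : Δ × Δ → ℂ`, `CL₃(ϕ,φ)` is a simple Lie
conformal algebra. -/
theorem stmt_19 (Δ : AddSubgroup ℂ) (φ : Δ →+ ℂ) (ϕ : Δ → Δ → ℂ)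
    (haddl : ∀ α β γ : Δ, ϕ (α + β) γ = ϕ α γ + ϕ β γ)
    (haddr : ∀ α β γ : Δ, ϕ α (β + γ) = ϕ α β + ϕ α γ)
    (hskew : ∀ α β : Δ, ϕ α β = - ϕ β α) :
    IsLieConf (B4 Δ φ ϕ) ∧ ConfSimple (B4 Δ φ ϕ) := by
  exact ⟨B4_lie Δ φ ϕ haddl haddr hskew, B4_simple Δ φ ϕ⟩
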